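/- Every sentence of FO(𝒟₀, ⊔, const, All) — first-order logic with team semantics augmented with all 0-ary first-order dependencies, global disjunction, the constancy atom, and the totality atom — is equivalent to some first-order sentence. -/

import Mathlib

namespace DSFO

/-- A purely relational signature: for each arity, a type of relation symbols. -/
abbrev Signature := ℕ → Type

/-- The empty signature. -/
def Sig0 : Signature := fun _ => Empty

/-- The signature with a single `k`-ary relation symbol `R`. -/
def SigR (k : ℕ) : Signature := fun n => PLift (n = k)

/-- Syntax of team-semantics formulas (in negation normal form, with the two
additional connectives: global disjunction `gdisj` and contradictory negation
`cneg`) over a relational signature `S`, with generalized dependency atoms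
indexed by `ι` with arities `ar`.  Variables are natural numbers. -/
inductive TS (S : Signature) (ι : Type) (ar : ι → ℕ) : Type
  | rel {k : ℕ} (r : S k) (v : Fin k → ℕ)
  | nrel {k : ℕ} (r : S k) (v : Fin k → ℕ)
  | eq (x y : ℕ)
  | neq (x y : ℕ)
  | dep (i : ι) (v : Fin (ar i) → ℕ)
  | and (φ ψ : TS S ι ar)
  | or (φ ψ : TS S ι ar)
  | gdisj (φ ψ : TS S ι ar)
  | cneg (φ : TS S ι ar)
  | ex (v : ℕ) (φ : TS S ι ar)
  | al (v : ℕ) (φ : TS S ι ar)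

/-- The always-true literal `⊤`. -/
def TS.top {S : Signature} {ι : Type} {ar : ι → ℕ} : TS S ι ar := .eq 0 0

/-- The arity function for "no dependency atoms". -/
def noAtoms : Empty → ℕ := fun e => e.elim

/-- First-order formulas over `S` (no dependency atoms; here `cneg` plays the
role of ordinary classical negation and `gdisj` of ordinary disjunction, so
this is full first-order logic). -/
abbrev FOF (S : Signature) := TS S Empty noAtoms

/-- First-order formulas over the empty signature. -/
abbrev EF := FOF Sig0

/-- Free variables of a formula. -/
def fv {S : Signature} {ι : Type} {ar : ι → ℕ} : TS S ι ar → Set ℕ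
  | .rel _ v => Set.range v
  | .nrel _ v => Set.range v
  | .eq x y => {x, y}
  | .neq x y => {x, y}
  | .dep _ v => Set.range v
  | .and φ ψ => fv φ ∪ fv ψ
  | .or φ ψ => fv φ ∪ fv ψ
  | .gdisj φ ψ => fv φ ∪ fv ψ
  | .cneg φ => fv φ
  | .ex v φ => fv φ \ {v}
  | .al v φ => fv φ \ {v}

/-- A sentence is a formula with no free variables. -/
def IsSentence {S : Signature} {ι : Type} {ar : ι → ℕ} (φ : TS S ι ar) : Prop :=
  fv φ = ∅

/-- No global disjunctions occur. -/
def NoGdisj {S : Signature} {ι : Type} {ar : ι → ℕ} : TS S ι ar → Prop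
  | .rel _ _ => True
  | .nrel _ _ => True
  | .eq _ _ => True
  | .neq _ _ => True
  | .dep _ _ => True
  | .and φ ψ => NoGdisj φ ∧ NoGdisj ψ
  | .or φ ψ => NoGdisj φ ∧ NoGdisj ψ
  | .gdisj _ _ => False
  | .cneg φ => NoGdisj φ
  | .ex _ φ => NoGdisj φ
  | .al _ φ => NoGdisj φ

/-- No contradictory negations occur. -/
def NoCneg {S : Signature} {ι : Type} {ar : ι → ℕ} : TS S ι ar → Prop
  | .rel _ _ => True
  | .nrel _ _ => True
  | .eq _ _ => True
  | .neq _ _ => True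
  | .dep _ _ => True
  | .and φ ψ => NoCneg φ ∧ NoCneg ψ
  | .or φ ψ => NoCneg φ ∧ NoCneg ψ
  | .gdisj φ ψ => NoCneg φ ∧ NoCneg ψ
  | .cneg _ => False
  | .ex _ φ => NoCneg φ
  | .al _ φ => NoCneg φ

/-- Formulas of `FO(𝒟)` proper: no `gdisj` and no `cneg`. -/
def Plain {S : Signature} {ι : Type} {ar : ι → ℕ} (φ : TS S ι ar) : Prop :=
  NoCneg φ ∧ NoGdisj φ

/-- Atomic formulas: first-order literals and dependency atoms. -/
def Atomic {S : Signature} {ι : Type} {ar : ι → ℕ} : TS S ι ar → Prop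
  | .rel _ _ => True
  | .nrel _ _ => True
  | .eq _ _ => True
  | .neq _ _ => True
  | .dep _ _ => True
  | _ => False

/-- Formulas of `FO(∼₀, 𝒟)`: the contradictory negation may appear only in
front of first-order literals and dependency atoms (and there is no `gdisj`). -/
def Cneg0 {S : Signature} {ι : Type} {ar : ι → ℕ} : TS S ι ar → Prop
  | .rel _ _ => True
  | .nrel _ _ => True
  | .eq _ _ => True
  | .neq _ _ => True
  | .dep _ _ => True
  | .and φ ψ => Cneg0 φ ∧ Cneg0 ψ
  | .or φ ψ => Cneg0 φ ∧ Cneg0 ψ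
  | .gdisj _ _ => False
  | .cneg φ => Atomic φ
  | .ex _ φ => Cneg0 φ
  | .al _ φ => Cneg0 φ

/-- The negation normal form of the (dual) negation of a formula. -/
def TS.nneg {S : Signature} {ι : Type} {ar : ι → ℕ} : TS S ι ar → TS S ι ar
  | .rel r v => .nrel r v
  | .nrel r v => .rel r v
  | .eq x y => .neq x y
  | .neq x y => .eq x y
  | .dep i v => .cneg (.dep i v)
  | .and φ ψ => .or (TS.nneg φ) (TS.nneg ψ)
  | .or φ ψ => .and (TS.nneg φ) (TS.nneg ψ)
  | .gdisj φ ψ => .and (TS.nneg φ) (TS.nneg ψ)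
  | .cneg φ => φ
  | .ex v φ => .al v (TS.nneg φ)
  | .al v φ => .ex v (TS.nneg φ)

/-- Iterated existential quantification over a list of variables. -/
def exs {S : Signature} {ι : Type} {ar : ι → ℕ} (l : List ℕ) (φ : TS S ι ar) :
    TS S ι ar := l.foldr TS.ex φ

/-- An interpretation of a relational signature in a domain `M`. -/
abbrev Interp (S : Signature) (M : Type) := ∀ k, S k → Set (Fin k → M)

/-- The unique interpretation of the empty signature. -/
def eI (M : Type) : Interp Sig0 M := fun _ e => e.elim

/-- The interpretation of `SigR k` given by a `k`-ary relation `R`. -/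
def interpR {k : ℕ} {M : Type} (R : Set (Fin k → M)) : Interp (SigR k) M :=
  fun _ r => {s | (fun i => s (Fin.cast r.down.symm i)) ∈ R}

/-- Tarskian (single-assignment) satisfaction.  Dependency atoms are
(vacuously) interpreted as true; this is only used on first-order formulas. -/
def FSat {S : Signature} {ι : Type} {ar : ι → ℕ} (M : Type) (I : Interp S M) :
    (ℕ → M) → TS S ι ar → Prop
  | s, .rel r v => (fun i => s (v i)) ∈ I _ r
  | s, .nrel r v => (fun i => s (v i)) ∉ I _ r
  | s, .eq x y => s x = s y
  | s, .neq x y => s x ≠ s y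
  | _, .dep _ _ => True
  | s, .and φ ψ => FSat M I s φ ∧ FSat M I s ψ
  | s, .or φ ψ => FSat M I s φ ∨ FSat M I s ψ
  | s, .gdisj φ ψ => FSat M I s φ ∨ FSat M I s ψ
  | s, .cneg φ => ¬ FSat M I s φ
  | s, .ex v φ => ∃ m : M, FSat M I (Function.update s v m) φ
  | s, .al v φ => ∀ m : M, FSat M I (Function.update s v m) φ

/-- Truth of a first-order sentence (Tarskian semantics). -/
def FOTrue {S : Signature} {ι : Type} {ar : ι → ℕ} (M : Type) (I : Interp S M)
    (φ : TS S ι ar) : Prop :=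
  ∀ s : ℕ → M, FSat M I s φ

/-- The relation `X(x̄)` determined by a team `X` and a tuple of variables `x̄`. -/
def teamProj {M : Type} {k : ℕ} (v : Fin k → ℕ) (X : Set (ℕ → M)) :
    Set (Fin k → M) := {t | ∃ s ∈ X, t = fun j => s (v j)}

/-- (Lax) team semantics.  `A` gives the semantics of each dependency atom as a
function of the relation `X(x̄)`. -/
def TSat {S : Signature} {ι : Type} {ar : ι → ℕ} (M : Type) (I : Interp S M)
    (A : ∀ i, Set (Fin (ar i) → M) → Prop) :
    TS S ι ar → Set (ℕ → M) → Prop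
  | .rel r v, X => ∀ s ∈ X, (fun i => s (v i)) ∈ I _ r
  | .nrel r v, X => ∀ s ∈ X, (fun i => s (v i)) ∉ I _ r
  | .eq x y, X => ∀ s ∈ X, s x = s y
  | .neq x y, X => ∀ s ∈ X, s x ≠ s y
  | .dep i v, X => A i (teamProj v X)
  | .and φ ψ, X => TSat M I A φ X ∧ TSat M I A ψ X
  | .or φ ψ, X => ∃ Y Z : Set (ℕ → M), Y ∪ Z = X ∧ TSat M I A φ Y ∧ TSat M I A ψ Z
  | .gdisj φ ψ, X => TSat M I A φ X ∨ TSat M I A ψ X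
  | .cneg φ, X => ¬ TSat M I A φ X
  | .ex v φ, X => ∃ H : (ℕ → M) → Set M, (∀ s ∈ X, (H s).Nonempty) ∧
      TSat M I A φ {s' | ∃ s ∈ X, ∃ m ∈ H s, s' = Function.update s v m}
  | .al v φ, X => TSat M I A φ {s' | ∃ s ∈ X, ∃ m : M, s' = Function.update s v m}

/-- Truth of a sentence under team semantics: satisfaction by the team of all
assignments (by locality, equivalent to satisfaction by `{∅}`). -/
def TTrue {S : Signature} {ι : Type} {ar : ι → ℕ} (M : Type) (I : Interp S M)
    (A : ∀ i, Set (Fin (ar i) → M) → Prop) (φ : TS S ι ar) : Prop :=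
  TSat M I A φ Set.univ

/-- A `k`-ary dependency predicate: a class of pairs `(M, R)`. -/
abbrev DepPred (k : ℕ) := ∀ M : Type, Set (Fin k → M) → Prop

/-- Closure under isomorphisms (part of the definition of a generalized
dependency). -/
def IsoClosed {k : ℕ} (D : DepPred k) : Prop :=
  ∀ (M N : Type) (e : M ≃ N) (R : Set (Fin k → M)),
    D M R → D N ((fun f => e ∘ f) '' R)

/-- The complement `∼D` of a dependency. -/
def complD {k : ℕ} (D : DepPred k) : DepPred k := fun M R => ¬ D M R

def DownwardsClosed {k : ℕ} (D : DepPred k) : Prop :=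
  ∀ (M : Type) (R R' : Set (Fin k → M)), D M R → R' ⊆ R → D M R'

/-- The downwards closure `D↓`. -/
def dClosure {k : ℕ} (D : DepPred k) : DepPred k :=
  fun M R => ∃ R', R ⊆ R' ∧ D M R'

/-- `D_max`: the maximal models of `D`. -/
def DMax {k : ℕ} (D : DepPred k) : DepPred k :=
  fun M R => D M R ∧ ∀ R', R ⊂ R' → ¬ D M R'

/-- The empty team property. -/
def EmptyTeamProp {k : ℕ} (D : DepPred k) : Prop :=
  ∀ M : Type, Nontrivial M → D M (∅ : Set (Fin k → M))

/-- `D` is a first-order dependency: it is the class of models of a first-order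
sentence over the signature `{R}`. -/
def FirstOrderDep {k : ℕ} (D : DepPred k) : Prop :=
  ∃ ψ : FOF (SigR k), IsSentence ψ ∧
    ∀ (M : Type), Nontrivial M → ∀ R : Set (Fin k → M),
      (D M R ↔ FOTrue M (interpR R) ψ)

/-- The interpretation of a unary predicate symbol as a subset of the domain. -/
def PSet {S : Signature} {M : Type} (I : Interp S M) (P : S 1) : Set M :=
  {m | (fun _ => m) ∈ I 1 P}

/-- Semantics of the relativization `D^(P)` of `D` to the unary predicate `P`:
`𝔐 ⊨_X D^(P) x̄` iff `(P^𝔐, X(x̄)) ∈ D`. -/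
def relSem {k : ℕ} (D : DepPred k) {S : Signature} (P : S 1)
    (M : Type) (I : Interp S M) (R : Set (Fin k → M)) : Prop :=
  (∀ f ∈ R, ∀ j, f j ∈ PSet I P) ∧
    D (↥(PSet I P)) {g : Fin k → ↥(PSet I P) | (fun j => (g j : M)) ∈ R}

/-- A family `𝒟` of generalized dependencies is strongly first order: every
sentence of `FO(𝒟)` is equivalent to some first-order sentence. -/
def SFOFam {ι : Type} {ar : ι → ℕ} (D : ∀ i, DepPred (ar i)) : Prop :=
  ∀ (S : Signature) (φ : TS S ι ar), IsSentence φ → Plain φ →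
    ∃ ψ : FOF S, IsSentence ψ ∧
      ∀ (M : Type), Nontrivial M → ∀ I : Interp S M,
        (TTrue M I (fun i => D i M) φ ↔ FOTrue M I ψ)

/-- A single dependency is strongly first order iff `{D}` is. -/
def SFOd {k : ℕ} (D : DepPred k) : Prop :=
  SFOFam (ι := Unit) (ar := fun _ => k) (fun _ => D)

/-- A family `𝒟` is relativizable: every sentence of `FO(𝒟^(P))` is equivalent
to some sentence of `FO(𝒟)`. -/
def RelativizableFam {ι : Type} {ar : ι → ℕ} (D : ∀ i, DepPred (ar i)) : Prop :=
  ∀ (S : Signature) (P : S 1) (φ : TS S ι ar), IsSentence φ → Plain φ →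
    ∃ ψ : TS S ι ar, IsSentence ψ ∧ Plain ψ ∧
      ∀ (M : Type), Nontrivial M → ∀ I : Interp S M,
        (TTrue M I (fun i => relSem (D i) P M I) φ ↔ TTrue M I (fun i => D i M) ψ)

def Relativizable1 {k : ℕ} (D : DepPred k) : Prop :=
  RelativizableFam (ι := Unit) (ar := fun _ => k) (fun _ => D)

/-- The family `𝒟 ∪ ∼𝒟`. -/
def withComplFam {ι : Type} {ar : ι → ℕ} (D : ∀ i, DepPred (ar i)) :
    ∀ i : ι ⊕ ι, DepPred (Sum.elim ar ar i) :=
  fun i => match i with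
    | .inl a => D a
    | .inr a => complD (D a)

/-- `D` is doubly strongly first order: `{D, ∼D}` is strongly first order. -/
def DSFOd {k : ℕ} (D : DepPred k) : Prop :=
  SFOFam (ι := Bool) (ar := fun _ => k)
    (fun b => match b with | true => D | false => complD D)

/-- The constancy atom of arity `k`. -/
def constD (k : ℕ) : DepPred k := fun _ R => ∀ f ∈ R, ∀ g ∈ R, f = g

/-- The totality atom of arity `k`. -/
def allD (k : ℕ) : DepPred k := fun M R => R = (Set.univ : Set (Fin k → M))

/-- The family `𝒟 ∪ {const}` (constancy atoms of every arity). -/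
def withConst {ι : Type} {ar : ι → ℕ} (D : ∀ i, DepPred (ar i)) :
    ∀ i : ι ⊕ ℕ, DepPred (Sum.elim ar id i) :=
  fun i => match i with
    | .inl a => D a
    | .inr n => constD n

/-- The atoms of `𝒟^(P) ∪ {const}`. -/
def withConstRel {ι : Type} {ar : ι → ℕ} (D : ∀ i, DepPred (ar i))
    {S : Signature} (P : S 1) (M : Type) (I : Interp S M) :
    ∀ i : ι ⊕ ℕ, Set (Fin (Sum.elim ar id i) → M) → Prop :=
  fun i => match i with
    | .inl a => relSem (D a) P M I
    | .inr n => constD n M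

/-- Atom indices of the logic `FO(𝒟₀, ⊔, const, All)`: the 0-ary first-order
dependencies `[ψ]`, the constancy atoms and the totality atoms. -/
inductive CIdx : Type
  | d0 (ψ : EF) (hψ : IsSentence ψ)
  | const (k : ℕ)
  | total (k : ℕ)

def cAr : CIdx → ℕ
  | .d0 _ _ => 0
  | .const k => k
  | .total k => k

def cSem (M : Type) : ∀ i : CIdx, Set (Fin (cAr i) → M) → Prop
  | .d0 ψ _, _ => FOTrue M (eI M) ψ
  | .const _, R => ∀ f ∈ R, ∀ g ∈ R, f = g
  | .total _, R => R = Set.univ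

/-- Embedding of first-order formulas over the empty signature into any
team logic. -/
def embedEF {S : Signature} {ι : Type} {ar : ι → ℕ} : EF → TS S ι ar
  | .rel r _ => Empty.elim r
  | .nrel r _ => Empty.elim r
  | .eq x y => .eq x y
  | .neq x y => .neq x y
  | .dep i _ => Empty.elim i
  | .and φ ψ => .and (embedEF φ) (embedEF ψ)
  | .or φ ψ => .or (embedEF φ) (embedEF ψ)
  | .gdisj φ ψ => .gdisj (embedEF φ) (embedEF ψ)
  | .cneg φ => .cneg (embedEF φ)
  | .ex v φ => .ex v (embedEF φ)
  | .al v φ => .al v (embedEF φ)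

/-- Override the values of the variables `0, …, k-1` by the tuple `f`. -/
def overrideFin {M : Type} (k : ℕ) (f : Fin k → M) (s : ℕ → M) : ℕ → M :=
  fun v => if h : v < k then f ⟨v, h⟩ else s v

/-- `(M, R) ⊨ ∃ȳ ∀x̄ (R x̄ → θ(x̄, ȳ))`, where `x̄` is the tuple of variables
`0, …, k-1` and the remaining free variables `ȳ` of `θ` are witnessed by `s`. -/
def ExAllSem {k : ℕ} (M : Type) (R : Set (Fin k → M)) (θ : EF) : Prop :=
  ∃ s : ℕ → M, ∀ f ∈ R, FSat M (eI M) (overrideFin k f s) θ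

/-- `(M, R) ⊨ ∃ȳ ∀x̄ (R x̄ ↔ θ(x̄, ȳ))`. -/
def ExAllIffSem {k : ℕ} (M : Type) (R : Set (Fin k → M)) (θ : EF) : Prop :=
  ∃ s : ℕ → M, ∀ f : Fin k → M, (f ∈ R ↔ FSat M (eI M) (overrideFin k f s) θ)

/-- The assignment sending `x̄ = (0, …, k-1)` to `f`, `ȳ = (k, …, k+n-1)` to
`a`, and every other variable to its value under `s0`. -/
def tupAsg {M : Type} (k n : ℕ) (f : Fin k → M) (a : Fin n → M) (s0 : ℕ → M) :
    ℕ → M :=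
  fun v => if h : v < k then f ⟨v, h⟩ else if h2 : v - k < n then a ⟨v - k, h2⟩ else s0 v

/-- `R` is defined by the formula `θ(x̄, ȳ)` (with `x̄ = (0, …, k-1)` and
`ȳ = (k, …, k+n-1)`): there is a tuple `ā` of parameters such that
`R = {m̄ : 𝔐 ⊨ θ(m̄, ā)}`. -/
def DefinedBy {S : Signature} {M : Type} (I : Interp S M) (k n : ℕ)
    (θ : FOF S) (R : Set (Fin k → M)) : Prop :=
  ∃ a : Fin n → M, ∀ s0 : ℕ → M, R = {f | FSat M I (tupAsg k n f a s0) θ}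

/-- `θ(x̄, ȳ)` fixes the identity type of `ȳ = (k, …, k+n-1)`. -/
def FixesIdType {S : Signature} (k n : ℕ) (θ : FOF S) : Prop :=
  ∀ i j : Fin n,
    (∀ (M : Type), Nontrivial M → ∀ (I : Interp S M) (s : ℕ → M),
        FSat M I s θ → s (k + (i : ℕ)) = s (k + (j : ℕ))) ∨
    (∀ (M : Type), Nontrivial M → ∀ (I : Interp S M) (s : ℕ → M),
        FSat M I s θ → s (k + (i : ℕ)) ≠ s (k + (j : ℕ)))

/-- `(M, R := Xv) ⊨ ∃ȳ ∀x̄ (R x̄ → θ(x̄, ȳ))` where the `x̄`-slots of `θ` are the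
variables `v̄` and the `ȳ`-slots are the variables `ȳ`. -/
def projExAll {M : Type} {k n : ℕ} (v : Fin k → ℕ) (y : Fin n → ℕ) (θ : EF)
    (Xv : Set (Fin k → M)) : Prop :=
  ∃ b : Fin n → M, ∀ f ∈ Xv, ∀ s : ℕ → M,
    (∀ j, s (v j) = f j) → (∀ i, s (y i) = b i) → FSat M (eI M) s θ


/-! ### Locality of Tarskian satisfaction -/

theorem fv_finite {S : Signature} {ι : Type} {ar : ι → ℕ} (φ : TS S ι ar) :
    (fv φ).Finite := by
  induction φ with
  | rel r v => exact Set.finite_range v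
  | nrel r v => exact Set.finite_range v
  | eq x y => exact Set.toFinite {x, y}
  | neq x y => exact Set.toFinite {x, y}
  | dep i v => exact Set.finite_range v
  | and φ ψ h₁ h₂ => exact h₁.union h₂
  | or φ ψ h₁ h₂ => exact h₁.union h₂
  | gdisj φ ψ h₁ h₂ => exact h₁.union h₂
  | cneg φ h => exact h
  | ex v φ h => exact h.subset Set.sdiff_subset
  | al v φ h => exact h.subset Set.sdiff_subset

theorem FSat_congr {S : Signature} {ι : Type} {ar : ι → ℕ} {M : Type} {I : Interp S M}
    (φ : TS S ι ar) {s s' : ℕ → M} (h : Set.EqOn s s' (fv φ)) :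
    FSat M I s φ ↔ FSat M I s' φ := by
  induction φ generalizing s s' with
  | rel r v =>
    have : (fun i => s (v i)) = fun i => s' (v i) := funext fun i => h ⟨i, rfl⟩
    simp only [FSat, this]
  | nrel r v =>
    have : (fun i => s (v i)) = fun i => s' (v i) := funext fun i => h ⟨i, rfl⟩
    simp only [FSat, this]
  | eq x y =>
    simp only [FSat, h (show x ∈ fv (TS.eq x y) from Or.inl rfl),
      h (show y ∈ fv (TS.eq x y) from Or.inr rfl)]
  | neq x y =>
    simp only [FSat, h (show x ∈ fv (TS.neq x y) from Or.inl rfl),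
      h (show y ∈ fv (TS.neq x y) from Or.inr rfl)]
  | dep i v => exact Iff.rfl
  | and φ ψ h₁ h₂ =>
    exact and_congr (h₁ (h.mono Set.subset_union_left)) (h₂ (h.mono Set.subset_union_right))
  | or φ ψ h₁ h₂ =>
    exact or_congr (h₁ (h.mono Set.subset_union_left)) (h₂ (h.mono Set.subset_union_right))
  | gdisj φ ψ h₁ h₂ =>
    exact or_congr (h₁ (h.mono Set.subset_union_left)) (h₂ (h.mono Set.subset_union_right))
  | cneg φ ih => exact not_congr (ih h)
  | ex v φ ih =>
    refine exists_congr fun m => ih fun x hx => ?_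
    by_cases hxv : x = v
    · subst hxv; simp
    · simpa [hxv] using h ⟨hx, hxv⟩
  | al v φ ih =>
    refine forall_congr' fun m => ih fun x hx => ?_
    by_cases hxv : x = v
    · subst hxv; simp
    · simpa [hxv] using h ⟨hx, hxv⟩

theorem FSat_exs {S : Signature} {ι : Type} {ar : ι → ℕ} {M : Type} {I : Interp S M}
    (l : List ℕ) (φ : TS S ι ar) (s : ℕ → M) :
    FSat M I s (exs l φ) ↔ ∃ s' : ℕ → M, (∀ x ∉ l, s' x = s x) ∧ FSat M I s' φ := by
  induction l generalizing s with
  | nil =>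
    constructor
    · exact fun h => ⟨s, fun _ _ => rfl, h⟩
    · rintro ⟨s', h, hs'⟩
      rwa [← show s' = s from funext fun x => h x List.not_mem_nil]
  | cons v l ih =>
    change (∃ m, FSat M I (Function.update s v m) (exs l φ)) ↔ _
    simp only [ih]
    constructor
    · rintro ⟨m, s', h, hs'⟩
      refine ⟨s', fun x hx => ?_, hs'⟩
      rw [List.mem_cons, not_or] at hx
      rw [h x hx.2, Function.update_of_ne hx.1]
    · rintro ⟨s', h, hs'⟩
      refine ⟨s' v, s', fun x hx => ?_, hs'⟩
      by_cases hxv : x = v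
      · subst hxv; simp
      · rw [Function.update_of_ne hxv]
        exact h x (by simp [hxv, hx])

theorem fv_exs {S : Signature} {ι : Type} {ar : ι → ℕ} (l : List ℕ) (φ : TS S ι ar) :
    fv (exs l φ) = fv φ \ {x | x ∈ l} := by
  induction l with
  | nil => simp [exs]
  | cons v l ih =>
    change fv (exs l φ) \ {v} = _
    rw [ih]
    ext x
    simp only [Set.mem_sdiff, Set.mem_ofPred_eq, Set.mem_singleton_iff, List.mem_cons]
    tauto

theorem fv_embedEF {S : Signature} {ι : Type} {ar : ι → ℕ} (ψ : EF) :
    fv (embedEF ψ : TS S ι ar) = fv ψ := by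
  induction ψ with
  | rel r v => exact r.elim
  | nrel r v => exact r.elim
  | dep i v => exact i.elim
  | _ => simp_all [embedEF, fv]

theorem FSat_embedEF {S : Signature} {ι : Type} {ar : ι → ℕ} {M : Type} (I : Interp S M)
    (ψ : EF) (s : ℕ → M) :
    FSat M I s (embedEF ψ : TS S ι ar) ↔ FSat M (eI M) s ψ := by
  induction ψ generalizing s with
  | rel r v => exact r.elim
  | nrel r v => exact r.elim
  | dep i v => exact i.elim
  | _ => simp_all [embedEF, FSat]

/-! ### First-order definable queries -/

/-- A query on assignments of the variables `α`. -/
abbrev Query (S : Signature) (α : Type) := ∀ M : Type, Interp S M → (α → M) → Prop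

/-- A query is first-order definable (over models with at least two elements) if it depends on
finitely many variables only and, for every naming of the variables by natural numbers, is
expressed by a first-order formula. -/
def Definable {S : Signature} {α : Type} (Q : Query S α) : Prop :=
  ∃ F : Set α, F.Finite ∧
    (∀ (M : Type) (_ : Nontrivial M) (I : Interp S M) (t t' : α → M),
      Set.EqOn t t' F → Q M I t → Q M I t') ∧
    ∀ e : α → ℕ, ∃ ψ : FOF S, fv ψ ⊆ e '' F ∧
      ∀ (M : Type) (_ : Nontrivial M) (I : Interp S M) (s : ℕ → M),
        FSat M I s ψ ↔ Q M I (s ∘ e)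

namespace Definable

variable {S : Signature} {α β : Type} {P Q : Query S α}

theorem congr (hQ : Definable Q)
    (h : ∀ (M : Type) (_ : Nontrivial M) (I : Interp S M) (t : α → M), Q M I t ↔ P M I t) :
    Definable P := by
  obtain ⟨F, hF, hloc, hdef⟩ := hQ
  refine ⟨F, hF, fun M hM I t t' htt' hP => ?_, fun e => ?_⟩
  · exact (h M hM I t').1 (hloc M hM I t t' htt' ((h M hM I t).2 hP))
  · obtain ⟨ψ, hfv, hψ⟩ := hdef e
    exact ⟨ψ, hfv, fun M hM I s => (hψ M hM I s).trans (h M hM I _)⟩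

theorem comp (hQ : Definable Q) (g : α → β) :
    Definable (fun M I t => Q M I (t ∘ g) : Query S β) := by
  obtain ⟨F, hF, hloc, hdef⟩ := hQ
  refine ⟨g '' F, hF.image g, fun M hM I t t' htt' => ?_, fun e => ?_⟩
  · exact hloc M hM I _ _ fun x hx => htt' ⟨x, hx, rfl⟩
  · obtain ⟨ψ, hfv, hψ⟩ := hdef (e ∘ g)
    exact ⟨ψ, by rwa [← Set.image_comp], hψ⟩

theorem not (hQ : Definable Q) : Definable (fun M I t => ¬ Q M I t : Query S α) := by
  obtain ⟨F, hF, hloc, hdef⟩ := hQ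
  refine ⟨F, hF, fun M hM I t t' htt' hP h => hP (hloc M hM I t' t htt'.symm h), fun e => ?_⟩
  obtain ⟨ψ, hfv, hψ⟩ := hdef e
  exact ⟨.cneg ψ, hfv, fun M hM I s => not_congr (hψ M hM I s)⟩

theorem and (hP : Definable P) (hQ : Definable Q) :
    Definable (fun M I t => P M I t ∧ Q M I t : Query S α) := by
  obtain ⟨F, hF, hloc, hdef⟩ := hP
  obtain ⟨G, hG, hloc', hdef'⟩ := hQ
  refine ⟨F ∪ G, hF.union hG, fun M hM I t t' htt' => ?_, fun e => ?_⟩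
  · exact And.imp (hloc M hM I t t' (htt'.mono Set.subset_union_left))
      (hloc' M hM I t t' (htt'.mono Set.subset_union_right))
  · obtain ⟨ψ, hfv, hψ⟩ := hdef e
    obtain ⟨χ, hfv', hχ⟩ := hdef' e
    refine ⟨.and ψ χ, ?_, fun M hM I s => and_congr (hψ M hM I s) (hχ M hM I s)⟩
    rw [Set.image_union]
    exact Set.union_subset_union hfv hfv'

theorem or (hP : Definable P) (hQ : Definable Q) :
    Definable (fun M I t => P M I t ∨ Q M I t : Query S α) :=
  (hP.not.and hQ.not).not.congr fun _ _ _ _ => by tauto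

theorem imp (hP : Definable P) (hQ : Definable Q) :
    Definable (fun M I t => P M I t → Q M I t : Query S α) :=
  (hP.and hQ.not).not.congr fun _ _ _ _ => by tauto

theorem sentence (ψ : FOF S) (hψ : IsSentence ψ) :
    Definable (fun M I _ => FOTrue M I ψ : Query S α) := by
  refine ⟨∅, Set.finite_empty, fun _ _ _ _ _ _ => id, fun e => ⟨ψ, ?_, fun M hM I s => ?_⟩⟩
  · rw [show fv ψ = ∅ from hψ]
    exact Set.empty_subset _
  · refine ⟨fun h s' => (FSat_congr ψ ?_).1 h, fun h => h s⟩
    rw [show fv ψ = ∅ from hψ]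
    exact Set.eqOn_empty _ _

theorem eq (a b : α) : Definable (fun _ _ t => t a = t b : Query S α) := by
  refine ⟨{a, b}, Set.toFinite _, fun M hM I t t' htt' h => ?_, fun e =>
    ⟨.eq (e a) (e b), ?_, fun M hM I s => Iff.rfl⟩⟩
  · exact (htt' (Or.inl rfl)).symm.trans (Eq.trans h (htt' (Or.inr rfl)))
  · rw [Set.image_pair]
    exact subset_rfl

theorem rel {k : ℕ} (r : S k) (v : Fin k → α) :
    Definable (fun _ I t => (fun i => t (v i)) ∈ I k r : Query S α) := by
  refine ⟨Set.range v, Set.finite_range v, fun M hM I t t' htt' h => ?_, fun e =>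
    ⟨.rel r (e ∘ v), ?_, fun M hM I s => Iff.rfl⟩⟩
  · have : (fun i => t (v i)) = fun i => t' (v i) := funext fun i => htt' ⟨i, rfl⟩
    exact Eq.subst (motive := (· ∈ I k r)) this h
  · rw [← Set.range_comp]
    exact subset_rfl

theorem true : Definable (fun _ _ _ => True : Query S α) := by
  refine (sentence (.al 0 (.eq 0 0)) ?_).congr fun M hM I t => ?_
  · simp [IsSentence, fv]
  · simp [FOTrue, FSat]

theorem false : Definable (fun _ _ _ => False : Query S α) :=
  true.not.congr fun _ _ _ _ => by simp

theorem forall_fin {k : ℕ} {Q : Fin k → Query S α} (h : ∀ j, Definable (Q j)) :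
    Definable (fun M I t => ∀ j, Q j M I t : Query S α) := by
  induction k with
  | zero => exact true.congr fun _ _ _ _ => by simp
  | succ k ih =>
    exact ((h 0).and (ih fun j => h j.succ)).congr fun M _ I t =>
      (Fin.forall_fin_succ (P := fun j => Q j M I t)).symm

theorem exists_tuple [Countable β] {Q : Query S (α ⊕ β)} (hQ : Definable Q) :
    Definable (fun M I t => ∃ b : β → M, Q M I (Sum.elim t b) : Query S α) := by
  obtain ⟨F, hF, hloc, hdef⟩ := hQ
  obtain ⟨g, hg⟩ := exists_injective_nat β
  have hA : (Sum.inl ⁻¹' F : Set α).Finite := hF.preimage Sum.inl_injective.injOn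
  have hB : (Sum.inr ⁻¹' F : Set β).Finite := hF.preimage Sum.inr_injective.injOn
  refine ⟨Sum.inl ⁻¹' F, hA, fun M hM I t t' htt' => ?_, fun e => ?_⟩
  · rintro ⟨b, hb⟩
    refine ⟨b, hloc M hM I _ _ ?_ hb⟩
    rintro (x | x) hx
    · exact htt' hx
    · rfl
  · obtain ⟨K, hK⟩ := (hA.image e).bddAbove
    have hK' : ∀ a, Sum.inl a ∈ F → e a ≤ K := fun a ha => hK ⟨a, ha, rfl⟩
    let e' : α ⊕ β → ℕ := Sum.elim e fun b => K + 1 + g b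
    obtain ⟨ψ, hfv, hψ⟩ := hdef e'
    let l : List ℕ := (hB.image fun b => K + 1 + g b).toFinset.toList
    have hl : ∀ x, x ∈ l ↔ ∃ b, Sum.inr b ∈ F ∧ K + 1 + g b = x := fun x => by
      simp [l]
    refine ⟨exs l ψ, ?_, fun M hM I s => ?_⟩
    · rw [fv_exs]
      rintro x ⟨hx, hxl⟩
      obtain ⟨a | b, hF', rfl⟩ := hfv hx
      · exact ⟨a, hF', rfl⟩
      · exact absurd ((hl _).2 ⟨b, hF', rfl⟩) hxl
    · rw [FSat_exs]
      constructor
      · rintro ⟨s', hs', h⟩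
        refine ⟨fun b => s' (K + 1 + g b), hloc M hM I _ _ ?_ ((hψ M hM I s').1 h)⟩
        rintro (a | b) hF'
        · refine hs' (e a) fun hmem => ?_
          obtain ⟨b, -, hb⟩ := (hl _).1 hmem
          have := hK' a hF'
          omega
        · rfl
      · rintro ⟨b, hb⟩
        classical
        refine ⟨fun x => if h : x ∈ l then b ((hl x).1 h).choose else s x,
          fun x hx => dif_neg hx, (hψ M hM I _).2 (hloc M hM I _ _ ?_ hb)⟩
        rintro (a | c) hF'
        · have : e a ∉ l := fun hmem => by
            obtain ⟨b, -, hb⟩ := (hl _).1 hmem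
            have := hK' a hF'
            omega
          simp [e', this]
        · have hmem : K + 1 + g c ∈ l := (hl _).2 ⟨c, hF', rfl⟩
          have hc : ((hl _).1 hmem).choose = c :=
            hg (by have := ((hl _).1 hmem).choose_spec.2; omega)
          change b c = if h : K + 1 + g c ∈ l then b ((hl _).1 h).choose else s (K + 1 + g c)
          rw [dif_pos hmem, hc]

theorem forall_tuple [Countable β] {Q : Query S (α ⊕ β)} (hQ : Definable Q) :
    Definable (fun M I t => ∀ b : β → M, Q M I (Sum.elim t b) : Query S α) :=
  hQ.not.exists_tuple.not.congr fun _ _ _ _ => by push Not; rfl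

theorem exists_update {Q : Query S (α ⊕ ℕ)} (hQ : Definable Q) (v : ℕ) :
    Definable (fun M I t => ∃ m : M,
      Q M I (Sum.elim (t ∘ Sum.inl) (Function.update (t ∘ Sum.inr) v m)) : Query S (α ⊕ ℕ)) := by
  have h := (hQ.comp (β := (α ⊕ ℕ) ⊕ Unit) (Sum.elim (fun a => .inl (.inl a))
    (Function.update (fun n => .inl (.inr n)) v (.inr ())))).exists_tuple
  have key : ∀ (M : Type) (t : α ⊕ ℕ → M) (b : Unit → M),
      Sum.elim t b ∘ Sum.elim (fun a => .inl (.inl a))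
        (Function.update (fun n => .inl (.inr n)) v (.inr ())) =
      Sum.elim (t ∘ Sum.inl) (Function.update (t ∘ Sum.inr) v (b ())) := by
    intro M t b
    funext x
    rcases x with a | n
    · rfl
    · by_cases hn : n = v
      · subst hn; simp
      · simp [hn]
  refine h.congr fun M hM I t => ?_
  simp only [key]
  exact ⟨fun ⟨b, hb⟩ => ⟨b (), hb⟩, fun ⟨m, hm⟩ => ⟨fun _ => m, hm⟩⟩

theorem forall_update {Q : Query S (α ⊕ ℕ)} (hQ : Definable Q) (v : ℕ) :
    Definable (fun M I t => ∀ m : M,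
      Q M I (Sum.elim (t ∘ Sum.inl) (Function.update (t ∘ Sum.inr) v m)) : Query S (α ⊕ ℕ)) :=
  (hQ.not.exists_update v).not.congr fun _ _ _ _ => by push Not; rfl

end Definable

/-! ### Resolved satisfaction

A choice sequence `p` resolves the constancy atoms (by providing the constant values) and the
global disjunctions (a disjunct is selected according to whether `p 0 = p 1`). -/

/-- The even-indexed part of a sequence. -/
abbrev evens {M : Type} (p : ℕ → M) : ℕ → M := p ∘ fun n => 2 * n

/-- The odd-indexed part of a sequence. -/
abbrev odds {M : Type} (p : ℕ → M) : ℕ → M := p ∘ fun n => 2 * n + 1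

/-- A sequence without its first two entries. -/
abbrev drop2 {M : Type} (p : ℕ → M) : ℕ → M := p ∘ fun n => n + 2

theorem exists_interleave {M : Type} (p q : ℕ → M) :
    ∃ r : ℕ → M, evens r = p ∧ odds r = q := by
  refine ⟨fun n => if n % 2 = 0 then p (n / 2) else q (n / 2), ?_, ?_⟩
  · funext n
    simp [evens]
  · funext n
    have h₁ : (2 * n + 1) % 2 = 1 := by omega
    have h₂ : (2 * n + 1) / 2 = n := by omega
    simp [odds, h₁, h₂]

theorem exists_prepend {M : Type} (a b : M) (p : ℕ → M) :
    ∃ r : ℕ → M, r 0 = a ∧ r 1 = b ∧ drop2 r = p :=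
  ⟨fun n => if n = 0 then a else if n = 1 then b else p (n - 2), by simp, by simp, by
    funext n; simp [drop2]⟩

/-- The flattening of a formula, resolved by a choice sequence: the condition that every
assignment of a team satisfying the formula must meet. -/
def RFlat {S : Signature} {M : Type} (I : Interp S M) :
    TS S CIdx cAr → (ℕ → M) → (ℕ → M) → Prop
  | .rel r v, _, s => (fun i => s (v i)) ∈ I _ r
  | .nrel r v, _, s => (fun i => s (v i)) ∉ I _ r
  | .eq x y, _, s => s x = s y
  | .neq x y, _, s => s x ≠ s y
  | .dep (.d0 _ _) _, _, _ => True
  | .dep (.const k) v, p, s => ∀ j : Fin k, s (v j) = p j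
  | .dep (.total _) _, _, _ => True
  | .and φ ψ, p, s => RFlat I φ (evens p) s ∧ RFlat I ψ (odds p) s
  | .or φ ψ, p, s => RFlat I φ (evens p) s ∨ RFlat I ψ (odds p) s
  | .gdisj φ ψ, p, s => (p 0 = p 1 ∧ RFlat I φ (drop2 p) s) ∨ (p 0 ≠ p 1 ∧ RFlat I ψ (drop2 p) s)
  | .cneg _, _, _ => True
  | .ex v φ, p, s => ∃ m, RFlat I φ p (Function.update s v m)
  | .al v φ, p, s => ∀ m, RFlat I φ p (Function.update s v m)

/-- Team satisfaction resolved by a choice sequence. -/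
def RSat {S : Signature} {M : Type} (I : Interp S M) :
    TS S CIdx cAr → (ℕ → M) → Set (ℕ → M) → Prop
  | .rel r v, _, X => ∀ s ∈ X, (fun i => s (v i)) ∈ I _ r
  | .nrel r v, _, X => ∀ s ∈ X, (fun i => s (v i)) ∉ I _ r
  | .eq x y, _, X => ∀ s ∈ X, s x = s y
  | .neq x y, _, X => ∀ s ∈ X, s x ≠ s y
  | .dep (.d0 ψ _) _, _, _ => FOTrue M (eI M) ψ
  | .dep (.const k) v, p, X => ∀ s ∈ X, ∀ j : Fin k, s (v j) = p j
  | .dep (.total k) v, _, X => ∀ y : Fin k → M, ∃ s ∈ X, ∀ j : Fin k, s (v j) = y j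
  | .and φ ψ, p, X => RSat I φ (evens p) X ∧ RSat I ψ (odds p) X
  | .or φ ψ, p, X => ∃ Y Z : Set (ℕ → M), Y ∪ Z = X ∧ RSat I φ (evens p) Y ∧ RSat I ψ (odds p) Z
  | .gdisj φ ψ, p, X => (p 0 = p 1 ∧ RSat I φ (drop2 p) X) ∨ (p 0 ≠ p 1 ∧ RSat I ψ (drop2 p) X)
  | .cneg _, _, _ => False
  | .ex v φ, p, X => ∃ H : (ℕ → M) → Set M, (∀ s ∈ X, (H s).Nonempty) ∧
      RSat I φ p {s' | ∃ s ∈ X, ∃ m ∈ H s, s' = Function.update s v m}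
  | .al v φ, p, X => RSat I φ p {s' | ∃ s ∈ X, ∃ m : M, s' = Function.update s v m}

section Resolution

variable {S : Signature} {M : Type} {I : Interp S M}

theorem TSat_iff_exists_RSat [Nontrivial M] (φ : TS S CIdx cAr) (hφ : NoCneg φ)
    (X : Set (ℕ → M)) : TSat M I (cSem M) φ X ↔ ∃ p, RSat I φ p X := by
  induction φ generalizing X with
  | rel r v => simp [TSat, RSat]
  | nrel r v => simp [TSat, RSat]
  | eq x y => simp [TSat, RSat]
  | neq x y => simp [TSat, RSat]
  | dep i v =>
    cases i with
    | d0 ψ h => simp [TSat, RSat, cSem]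
    | const k =>
      simp only [TSat, RSat, cSem]
      constructor
      · intro h
        obtain rfl | ⟨s₀, hs₀⟩ := X.eq_empty_or_nonempty
        · exact ⟨fun _ => Classical.arbitrary M, by simp⟩
        · refine ⟨fun n => if hn : n < k then s₀ (v ⟨n, hn⟩) else Classical.arbitrary M,
            fun s hs j => ?_⟩
          change _ = dite _ _ _
          rw [dif_pos j.isLt]
          exact congrFun (h _ ⟨s, hs, rfl⟩ _ ⟨s₀, hs₀, rfl⟩) j
      · rintro ⟨p, hp⟩ _ ⟨s, hs, rfl⟩ _ ⟨s', hs', rfl⟩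
        funext j
        exact (hp s hs j).trans (hp s' hs' j).symm
    | total k =>
      simp only [TSat, RSat, cSem, exists_const]
      rw [Set.eq_univ_iff_forall]
      refine forall_congr' fun y => exists_congr fun s => and_congr_right fun _ => ?_
      exact ⟨fun h j => (congrFun h j).symm, fun h => funext fun j => (h j).symm⟩
  | and φ ψ h₁ h₂ =>
    simp only [TSat, RSat, h₁ hφ.1, h₂ hφ.2]
    constructor
    · rintro ⟨⟨p, hp⟩, q, hq⟩
      obtain ⟨r, rfl, rfl⟩ := exists_interleave p q
      exact ⟨r, hp, hq⟩
    · rintro ⟨r, hp, hq⟩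
      exact ⟨⟨_, hp⟩, _, hq⟩
  | or φ ψ h₁ h₂ =>
    simp only [TSat, RSat, h₁ hφ.1, h₂ hφ.2]
    constructor
    · rintro ⟨Y, Z, h, ⟨p, hp⟩, q, hq⟩
      obtain ⟨r, rfl, rfl⟩ := exists_interleave p q
      exact ⟨r, Y, Z, h, hp, hq⟩
    · rintro ⟨r, Y, Z, h, hp, hq⟩
      exact ⟨Y, Z, h, ⟨_, hp⟩, _, hq⟩
  | gdisj φ ψ h₁ h₂ =>
    simp only [TSat, RSat, h₁ hφ.1, h₂ hφ.2]
    constructor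
    · rintro (⟨p, hp⟩ | ⟨p, hp⟩)
      · obtain ⟨r, h0, h1, rfl⟩ :=
          exists_prepend (Classical.arbitrary M) (Classical.arbitrary M) p
        exact ⟨r, .inl ⟨h0.trans h1.symm, hp⟩⟩
      · obtain ⟨a, b, hab⟩ := exists_pair_ne M
        obtain ⟨r, rfl, rfl, rfl⟩ := exists_prepend a b p
        exact ⟨r, .inr ⟨hab, hp⟩⟩
    · rintro ⟨r, ⟨-, h⟩ | ⟨-, h⟩⟩
      · exact .inl ⟨_, h⟩
      · exact .inr ⟨_, h⟩
  | cneg φ ih => exact hφ.elim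
  | ex v φ ih =>
    simp only [TSat, RSat, ih hφ]
    constructor
    · rintro ⟨H, hH, p, hp⟩
      exact ⟨p, H, hH, hp⟩
    · rintro ⟨p, H, hH, hp⟩
      exact ⟨H, hH, p, hp⟩
  | al v φ ih => simp only [TSat, RSat, ih hφ]

theorem RSat.flat {φ : TS S CIdx cAr} {p : ℕ → M} {X : Set (ℕ → M)} (h : RSat I φ p X) :
    ∀ s ∈ X, RFlat I φ p s := by
  induction φ generalizing p X with
  | rel r v => exact h
  | nrel r v => exact h
  | eq x y => exact h
  | neq x y => exact h
  | dep i v =>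
    cases i with
    | d0 ψ hψ => exact fun _ _ => trivial
    | const k => exact h
    | total k => exact fun _ _ => trivial
  | and φ ψ h₁ h₂ => exact fun s hs => ⟨h₁ h.1 s hs, h₂ h.2 s hs⟩
  | or φ ψ h₁ h₂ =>
    obtain ⟨Y, Z, rfl, hY, hZ⟩ := h
    exact fun s hs => hs.imp (h₁ hY s) (h₂ hZ s)
  | gdisj φ ψ h₁ h₂ =>
    exact fun s hs => h.imp (fun h => ⟨h.1, h₁ h.2 s hs⟩) (fun h => ⟨h.1, h₂ h.2 s hs⟩)
  | cneg φ ih => exact h.elim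
  | ex v φ ih =>
    obtain ⟨H, hH, h⟩ := h
    intro s hs
    obtain ⟨m, hm⟩ := hH s hs
    exact ⟨m, ih h _ ⟨s, hs, m, hm, rfl⟩⟩
  | al v φ ih => exact fun s hs m => ih h _ ⟨s, hs, m, rfl⟩

theorem RSat.mono {φ : TS S CIdx cAr} {p : ℕ → M} {X Y : Set (ℕ → M)} (h : RSat I φ p X)
    (hXY : X ⊆ Y) (hY : ∀ s ∈ Y, RFlat I φ p s) : RSat I φ p Y := by
  induction φ generalizing p X Y with
  | rel r v => exact hY
  | nrel r v => exact hY
  | eq x y => exact hY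
  | neq x y => exact hY
  | dep i v =>
    cases i with
    | d0 ψ hψ => exact h
    | const k => exact hY
    | total k =>
      intro y
      obtain ⟨s, hs, hsy⟩ := h y
      exact ⟨s, hXY hs, hsy⟩
  | and φ ψ h₁ h₂ =>
    exact ⟨h₁ h.1 hXY fun s hs => (hY s hs).1, h₂ h.2 hXY fun s hs => (hY s hs).2⟩
  | or φ ψ h₁ h₂ =>
    obtain ⟨A, B, rfl, hA, hB⟩ := h
    refine ⟨{s ∈ Y | RFlat I φ (evens p) s}, {s ∈ Y | RFlat I ψ (odds p) s}, ?_,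
      h₁ hA (fun s hs => ⟨hXY (.inl hs), hA.flat s hs⟩) fun s hs => hs.2,
      h₂ hB (fun s hs => ⟨hXY (.inr hs), hB.flat s hs⟩) fun s hs => hs.2⟩
    ext s
    refine ⟨fun hs => hs.elim And.left And.left, fun hs => ?_⟩
    exact (hY s hs).imp (fun h => ⟨hs, h⟩) (fun h => ⟨hs, h⟩)
  | gdisj φ ψ h₁ h₂ =>
    refine h.imp (fun h => ⟨h.1, h₁ h.2 hXY fun s hs => ?_⟩)
      (fun h => ⟨h.1, h₂ h.2 hXY fun s hs => ?_⟩)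
    · exact (hY s hs).elim And.right fun h' => absurd h.1 h'.1
    · exact (hY s hs).elim (fun h' => absurd h'.1 h.1) And.right
  | cneg φ ih => exact h.elim
  | ex v φ ih =>
    obtain ⟨H, hH, h⟩ := h
    refine ⟨fun s => {m | RFlat I φ p (Function.update s v m)}, hY, ih h ?_ ?_⟩
    · rintro _ ⟨s, hs, m, hm, rfl⟩
      exact ⟨s, hXY hs, m, h.flat _ ⟨s, hs, m, hm, rfl⟩, rfl⟩
    · rintro _ ⟨s, hs, m, hm, rfl⟩
      exact hm
  | al v φ ih =>
    refine ih h ?_ ?_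
    · rintro _ ⟨s, hs, m, rfl⟩
      exact ⟨s, hXY hs, m, rfl⟩
    · rintro _ ⟨s, hs, m, rfl⟩
      exact hY s hs m

theorem RSat_or_iff (φ ψ : TS S CIdx cAr) (p : ℕ → M) (X : Set (ℕ → M)) :
    RSat I (.or φ ψ) p X ↔ (∀ s ∈ X, RFlat I (.or φ ψ) p s) ∧
      RSat I φ (evens p) {s | s ∈ X ∧ RFlat I φ (evens p) s} ∧
      RSat I ψ (odds p) {s | s ∈ X ∧ RFlat I ψ (odds p) s} := by
  constructor
  · intro h
    refine ⟨h.flat, ?_⟩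
    obtain ⟨Y, Z, rfl, hY, hZ⟩ := h
    exact ⟨hY.mono (fun s hs => ⟨.inl hs, hY.flat s hs⟩) fun s hs => hs.2,
      hZ.mono (fun s hs => ⟨.inr hs, hZ.flat s hs⟩) fun s hs => hs.2⟩
  · rintro ⟨h, h₁, h₂⟩
    refine ⟨_, _, ?_, h₁, h₂⟩
    ext s
    refine ⟨fun hs => hs.elim And.left And.left, fun hs => ?_⟩
    exact (h s hs).imp (fun h => ⟨hs, h⟩) (fun h => ⟨hs, h⟩)

theorem exists_eq_update_iff (v : ℕ) (X : Set (ℕ → M)) (s' : ℕ → M) :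
    (∃ s ∈ X, ∃ m, s' = Function.update s v m) ↔ ∃ m, Function.update s' v m ∈ X := by
  constructor
  · rintro ⟨s, hs, m, rfl⟩
    exact ⟨s v, by simpa using hs⟩
  · rintro ⟨m, hm⟩
    exact ⟨_, hm, s' v, by simp⟩

theorem RSat_ex_iff (v : ℕ) (φ : TS S CIdx cAr) (p : ℕ → M) (X : Set (ℕ → M)) :
    RSat I (.ex v φ) p X ↔ (∀ s ∈ X, RFlat I (.ex v φ) p s) ∧
      RSat I φ p {s | (∃ m, Function.update s v m ∈ X) ∧ RFlat I φ p s} := by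
  have key : {s' | ∃ s ∈ X, ∃ m ∈ {m | RFlat I φ p (Function.update s v m)},
      s' = Function.update s v m} =
      {s | (∃ m, Function.update s v m ∈ X) ∧ RFlat I φ p s} := by
    ext s'
    rw [Set.mem_ofPred_eq, Set.mem_ofPred_eq, ← exists_eq_update_iff]
    constructor
    · rintro ⟨s, hs, m, hm, rfl⟩
      exact ⟨⟨s, hs, m, rfl⟩, hm⟩
    · rintro ⟨⟨s, hs, m, rfl⟩, hm⟩
      exact ⟨s, hs, m, hm, rfl⟩
  rw [← key]
  constructor
  · intro h
    refine ⟨h.flat, ?_⟩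
    obtain ⟨H, hH, h⟩ := h
    refine h.mono ?_ ?_
    · rintro _ ⟨s, hs, m, hm, rfl⟩
      exact ⟨s, hs, m, h.flat _ ⟨s, hs, m, hm, rfl⟩, rfl⟩
    · rintro _ ⟨s, hs, m, hm, rfl⟩
      exact hm
  · rintro ⟨h, h'⟩
    exact ⟨_, h, h'⟩

theorem RSat_al_iff (v : ℕ) (φ : TS S CIdx cAr) (p : ℕ → M) (X : Set (ℕ → M)) :
    RSat I (.al v φ) p X ↔ RSat I φ p {s | ∃ m, Function.update s v m ∈ X} := by
  simp only [RSat, exists_eq_update_iff]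

end Resolution

/-! ### Definability of resolved satisfaction -/

section ResolutionDefinable

variable {S : Signature} {α : Type}

theorem definable_RFlat (φ : TS S CIdx cAr) (g : ℕ → α) :
    Definable (fun _ I t => RFlat I φ (t ∘ Sum.inl ∘ g) (t ∘ Sum.inr) : Query S (α ⊕ ℕ)) := by
  induction φ generalizing g with
  | rel r v => exact .rel r fun i => Sum.inr (v i)
  | nrel r v => exact (Definable.rel r fun i => Sum.inr (v i)).not
  | eq x y => exact .eq (Sum.inr x) (Sum.inr y)
  | neq x y => exact (Definable.eq (Sum.inr x) (Sum.inr y)).not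
  | dep i v =>
    cases i with
    | d0 ψ hψ => exact .true
    | const k => exact Definable.forall_fin fun j : Fin k =>
        Definable.eq (Sum.inr (v j)) (Sum.inl (g j))
    | total k => exact .true
  | and φ ψ h₁ h₂ => exact (h₁ _).and (h₂ _)
  | or φ ψ h₁ h₂ => exact (h₁ _).or (h₂ _)
  | gdisj φ ψ h₁ h₂ =>
    have h := Definable.eq (S := S) (α := α ⊕ ℕ) (.inl (g 0)) (.inl (g 1))
    exact (h.and (h₁ _)).or (h.not.and (h₂ _))
  | cneg φ ih => exact .true
  | ex v φ ih => exact (ih g).exists_update v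
  | al v φ ih => exact (ih g).forall_update v

theorem definable_forall_mem_RFlat (φ : TS S CIdx cAr) (g : ℕ → α) {Q : Query S (α ⊕ ℕ)}
    (hQ : Definable Q) :
    Definable (fun M I t => ∀ s ∈ {s | Q M I (Sum.elim t s)}, RFlat I φ (t ∘ g) s :
      Query S α) :=
  (hQ.imp (definable_RFlat φ g)).forall_tuple

theorem definable_RSat (φ : TS S CIdx cAr) (g : ℕ → α) {Q : Query S (α ⊕ ℕ)}
    (hQ : Definable Q) :
    Definable (fun M I t => RSat I φ (t ∘ g) {s | Q M I (Sum.elim t s)} : Query S α) := by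
  induction φ generalizing g Q with
  | rel r v => exact definable_forall_mem_RFlat (.rel r v) g hQ
  | nrel r v => exact definable_forall_mem_RFlat (.nrel r v) g hQ
  | eq x y => exact definable_forall_mem_RFlat (.eq x y) g hQ
  | neq x y => exact definable_forall_mem_RFlat (.neq x y) g hQ
  | dep i v =>
    cases i with
    | d0 ψ hψ =>
      refine (Definable.sentence (embedEF ψ) ((fv_embedEF ψ).trans hψ)).congr fun M hM I t => ?_
      exact forall_congr' fun s => FSat_embedEF I ψ s
    | const k => exact definable_forall_mem_RFlat (.dep (.const k) v) g hQ
    | total k =>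
      have h₁ := hQ.comp (β := (α ⊕ Fin k) ⊕ ℕ) (Sum.map Sum.inl id)
      have h₂ := Definable.forall_fin fun j : Fin k =>
        Definable.eq (S := S) (α := (α ⊕ Fin k) ⊕ ℕ) (.inr (v j)) (.inl (.inr j))
      refine (h₁.and h₂).exists_tuple.forall_tuple.congr fun M hM I t => ?_
      refine forall_congr' fun y => exists_congr fun s => and_congr_left fun _ => ?_
      rw [Sum.elim_comp_map]
      rfl
  | and φ ψ h₁ h₂ => exact (h₁ _ hQ).and (h₂ _ hQ)
  | or φ ψ h₁ h₂ =>
    refine ((definable_forall_mem_RFlat (.or φ ψ) g hQ).and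
      ((h₁ (evens g) (hQ.and (definable_RFlat φ (evens g)))).and
        (h₂ (odds g) (hQ.and (definable_RFlat ψ (odds g)))))).congr fun M hM I t => ?_
    exact (RSat_or_iff φ ψ (t ∘ g) _).symm
  | gdisj φ ψ h₁ h₂ =>
    have h := Definable.eq (S := S) (g 0) (g 1)
    exact (h.and (h₁ _ hQ)).or (h.not.and (h₂ _ hQ))
  | cneg φ ih => exact .false
  | ex v φ ih =>
    refine ((definable_forall_mem_RFlat (.ex v φ) g hQ).and
      (ih g ((hQ.exists_update v).and (definable_RFlat φ g)))).congr fun M hM I t => ?_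
    exact (RSat_ex_iff v φ (t ∘ g) _).symm
  | al v φ ih =>
    refine (ih g (hQ.exists_update v)).congr fun M hM I t => ?_
    exact (RSat_al_iff v φ (t ∘ g) {s | Q M I (Sum.elim t s)}).symm

end ResolutionDefinable

/-- Every sentence of `FO(𝒟₀, ⊔, const, All)` is equivalent to
some first-order sentence. -/
theorem d0_gdisj_const_all_sfo (S : Signature) (φ : TS S CIdx cAr)
    (hsen : IsSentence φ) (hc : NoCneg φ) :
    ∃ ψ : FOF S, IsSentence ψ ∧
      ∀ (M : Type), Nontrivial M → ∀ I : Interp S M,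
        (TTrue M I (cSem M) φ ↔ FOTrue M I ψ) := by
  have hR := definable_RSat φ (α := Empty ⊕ ℕ) Sum.inr Definable.true
  obtain ⟨F, -, -, hdef⟩ := hR.exists_tuple
  obtain ⟨ψ, hfv, hψ⟩ := hdef Empty.elim
  have hsent : fv ψ = ∅ := by
    rw [Set.eq_empty_of_isEmpty F, Set.image_empty] at hfv
    exact Set.subset_empty_iff.1 hfv
  refine ⟨ψ, hsent, fun M hM I => ?_⟩
  have h : TTrue M I (cSem M) φ ↔ ∃ p, RSat I φ p Set.univ := TSat_iff_exists_RSat φ hc _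
  rw [h]
  refine Iff.trans ?_ (forall_congr' fun s => (hψ M hM I s).symm)
  exact ⟨fun h _ => h, fun h => h fun _ => Classical.arbitrary M⟩

end DSFO
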